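/- arXiv:1609.04744 — 2 statements merged into one kernel-verified Lean document; each statement's English description precedes it below -/
import Mathlib

section
/- Let p ∈ (1,∞] with conjugate exponent q = p/(p−1) (q = 1 when p = ∞), let μ ∈ P(E), and let α(ν) = ‖dν/dμ‖_{L^p(μ)} − 1 for ν ≪ μ and α(ν) = ∞ otherwise. Then for every n ≥ 1 and every ν ∈ P(E^n) with ν ≪ μ^n, α_n(ν) ≤ n^{1/q} ‖dν/dμ^n‖_{L^p(μ^n)}. -/
open MeasureTheory ProbabilityTheory Filter Topology Set
open scoped ENNReal NNReal

noncomputable section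

namespace SanovDual

attribute [local instance] Classical.propDecidable

/-- The integral of an `EReal`-valued function, with the convention `∞ - ∞ := -∞`. -/
def erealIntegral {X : Type*} [MeasurableSpace X] (μ : Measure X) (f : X → EReal) : EReal :=
  if (∫⁻ x, (if f x = ⊥ then ⊤ else ENNReal.ofReal (-(f x).toReal)) ∂μ) = ⊤ then ⊥
  else ((∫⁻ x, (if f x = ⊤ then ⊤ else ENNReal.ofReal ((f x).toReal)) ∂μ : ℝ≥0∞) : EReal)
      - ((∫⁻ x, (if f x = ⊥ then ⊤ else ENNReal.ofReal (-(f x).toReal)) ∂μ : ℝ≥0∞) : EReal)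

/-- Extension of a function on probability measures to all measures (value `∞` elsewhere). -/
def extend {E : Type*} [MeasurableSpace E] (α : ProbabilityMeasure E → EReal)
    (μ : Measure E) : EReal :=
  if h : IsProbabilityMeasure μ then α ⟨μ, h⟩ else ⊤

/-- The conditional law of the `k`-th coordinate given the first `k` coordinates (`0`-indexed:
given coordinates `0, …, k-1`), under a probability measure on `Fin n → E`. -/
def condLaw {E : Type*} [MeasurableSpace E] [TopologicalSpace E] [PolishSpace E] [BorelSpace E]
    [Nonempty E] (n : ℕ) (ν : ProbabilityMeasure (Fin n → E)) (k : Fin n) :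
    Kernel (Fin (k : ℕ) → E) E :=
  Measure.condKernel ((ν : Measure (Fin n → E)).map
      (fun x => ((fun i : Fin (k : ℕ) => x (Fin.castLE k.isLt.le i)), x k)))

/-- The functional `α_n` on `P(E^n)` built from `α` by summing `α` applied to the successive
conditional laws in the disintegration. -/
def alphan {E : Type*} [MeasurableSpace E] [TopologicalSpace E] [PolishSpace E] [BorelSpace E]
    [Nonempty E] (α : ProbabilityMeasure E → EReal) (n : ℕ)
    (ν : ProbabilityMeasure (Fin n → E)) : EReal :=
  ∑ k : Fin n, erealIntegral (ν : Measure (Fin n → E))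
    (fun x => extend α (condLaw n ν k (fun i => x (Fin.castLE k.isLt.le i))))

/-- The convex conjugate `ρ_n` of `α_n`, acting on (extended-real-valued) functions on `E^n`. -/
def rhon {E : Type*} [MeasurableSpace E] [TopologicalSpace E] [PolishSpace E] [BorelSpace E]
    [Nonempty E] (α : ProbabilityMeasure E → EReal) (n : ℕ) (f : (Fin n → E) → EReal) : EReal :=
  ⨆ ν : ProbabilityMeasure (Fin n → E), erealIntegral (ν : Measure (Fin n → E)) f - alphan α n ν

/-- `ρ = ρ₁` on bounded (real-valued) functions. -/
def rho {E : Type*} [MeasurableSpace E] (α : ProbabilityMeasure E → EReal) (f : E → ℝ) : EReal :=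
  ⨆ ν : ProbabilityMeasure E, ((∫ x, f x ∂(ν : Measure E) : ℝ) : EReal) - α ν

/-- `ρ` on extended-real-valued functions, with the convention `∞ - ∞ := -∞` for integrals. -/
def rhoE {E : Type*} [MeasurableSpace E] (α : ProbabilityMeasure E → EReal) (f : E → EReal) :
    EReal :=
  ⨆ ν : ProbabilityMeasure E, erealIntegral (ν : Measure E) f - α ν

/-- `ρ` on `[0,∞]`-valued functions. -/
def rhoNN {E : Type*} [MeasurableSpace E] (α : ProbabilityMeasure E → EReal) (g : E → ℝ≥0∞) :
    EReal :=
  ⨆ ν : ProbabilityMeasure E, ((∫⁻ x, g x ∂(ν : Measure E) : ℝ≥0∞) : EReal) - α ν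

/-- The empirical measure `L_n(x) = n⁻¹ ∑ δ_{x_i}` as a measure. -/
def empMeasure {E : Type*} [MeasurableSpace E] (n : ℕ) (x : Fin n → E) : Measure E :=
  (n : ℝ≥0∞)⁻¹ • ∑ i : Fin n, Measure.dirac (x i)

/-- The empirical measure `L_n(x)` as a probability measure (junk value for `n = 0`). -/
def empirical {E : Type*} [MeasurableSpace E] [Nonempty E] (n : ℕ) (x : Fin n → E) :
    ProbabilityMeasure E :=
  if h : IsProbabilityMeasure (empMeasure n x) then ⟨empMeasure n x, h⟩
  else ⟨Measure.dirac (Classical.arbitrary E), inferInstance⟩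

/-- `P_ψ(E)`, the probability measures integrating `ψ`. -/
def Pw (E : Type*) [MeasurableSpace E] (ψ : E → ℝ) : Type _ :=
  {ν : ProbabilityMeasure E // ∫⁻ x, ENNReal.ofReal (ψ x) ∂(ν : Measure E) ≠ ⊤}

/-- The underlying probability measure of an element of `P_ψ(E)`. -/
def Pw.toProb {E : Type*} [MeasurableSpace E] {ψ : E → ℝ} (ν : Pw E ψ) :
    ProbabilityMeasure E :=
  Subtype.val ν

/-- The `ψ`-weak topology on `P_ψ(E)`: the topology generated by the maps `ν ↦ ∫ f dν` over
continuous `f : E → ℝ` with `|f| ≤ 1 + ψ`. -/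
instance {E : Type*} [MeasurableSpace E] [TopologicalSpace E] (ψ : E → ℝ) :
    TopologicalSpace (Pw E ψ) :=
  ⨅ (f : E → ℝ) (_ : Continuous f) (_ : ∀ x, |f x| ≤ 1 + ψ x),
    TopologicalSpace.induced (fun ν : Pw E ψ => ∫ x, f x ∂(ν.toProb : Measure E)) inferInstance

/-- Lift a function on `P_ψ(E)` to one on `P(E)` (junk value `⊤` off `P_ψ(E)`). -/
def liftPw {E : Type*} [MeasurableSpace E] (ψ : E → ℝ) (F : Pw E ψ → EReal)
    (ν : ProbabilityMeasure E) : EReal :=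
  if h : ∫⁻ x, ENNReal.ofReal (ψ x) ∂(ν : Measure E) ≠ ⊤ then F ⟨ν, h⟩ else ⊤

/-- The canonical map `EReal → ℝ≥0∞`. -/
def erealToENNReal (x : EReal) : ℝ≥0∞ :=
  if x = ⊤ then ⊤ else ENNReal.ofReal x.toReal

instance {E : Type*} [MeasurableSpace E] : MeasurableSpace (ProbabilityMeasure E) :=
  Subtype.instMeasurableSpace

/-- The `L^p`-entropy `α(ν) = ‖dν/dμ‖_{L^p(μ)} − 1` (`∞` if `ν` is not absolutely continuous
with respect to `μ`). -/
def lpAlpha {E : Type*} [MeasurableSpace E] (μ : Measure E) (p : ℝ≥0∞)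
    (ν : ProbabilityMeasure E) : EReal :=
  if (ν : Measure E) ≪ μ then
    ((eLpNorm (fun x => ((ν : Measure E).rnDeriv μ x).toReal) p μ : ℝ≥0∞) : EReal) - 1
  else ⊤

theorem coe_finset_sum {ι : Type*} (s : Finset ι) (f : ι → ℝ≥0∞) :
    ((∑ i ∈ s, f i : ℝ≥0∞) : EReal) = ∑ i ∈ s, (f i : EReal) := by
  classical
  induction s using Finset.induction_on with
  | empty => simp
  | insert a s ha ih => rw [Finset.sum_insert ha, Finset.sum_insert ha, EReal.coe_ennreal_add, ih]

theorem erealIntegral_le_lintegral {X : Type*} [MeasurableSpace X] {μ : Measure X} {f : X → EReal}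
    {G : X → ℝ≥0∞} (h : ∀ᵐ x ∂μ, f x ≤ G x) :
    erealIntegral μ f ≤ ((∫⁻ x, G x ∂μ : ℝ≥0∞) : EReal) := by
  unfold erealIntegral
  split_ifs with hneg
  · exact bot_le
  · refine EReal.sub_le_of_le_add (le_trans ?_ (le_add_of_nonneg_right (EReal.coe_ennreal_nonneg _)))
    rw [EReal.coe_ennreal_le_coe_ennreal_iff]
    refine lintegral_mono_ae ?_
    filter_upwards [h] with x hx
    have h' := EReal.toENNReal_le_toENNReal hx
    rw [EReal.toENNReal_coe] at h'
    refine le_trans (le_of_eq ?_) h'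
    unfold EReal.toENNReal
    split_ifs <;> rfl

theorem eLpNorm_toReal_of_lt_top {X : Type*} [MeasurableSpace X] {μ : Measure X} {f : X → ℝ≥0∞}
    (hf : ∀ᵐ x ∂μ, f x < ⊤) (p : ℝ≥0∞) :
    eLpNorm (fun x => (f x).toReal) p μ = eLpNorm f p μ := by
  refine eLpNorm_congr_enorm_ae ?_
  filter_upwards [hf] with x hx
  simp [hx.ne]

theorem extend_lpAlpha_le {E : Type*} [MeasurableSpace E] {μ κ : Measure E}
    [IsProbabilityMeasure κ] (hκ : κ ≪ μ) (p : ℝ≥0∞) :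
    extend (lpAlpha μ p) κ ≤ ((eLpNorm (κ.rnDeriv μ) p μ - 1 : ℝ≥0∞) : EReal) := by
  simp only [extend, ‹IsProbabilityMeasure κ›, dite_true, lpAlpha, ProbabilityMeasure.coe_mk, hκ, if_true]
  rw [eLpNorm_toReal_of_lt_top (κ.rnDeriv_lt_top μ)]
  refine EReal.sub_le_of_le_add ?_
  have h : eLpNorm (κ.rnDeriv μ) p μ ≤ eLpNorm (κ.rnDeriv μ) p μ - 1 + 1 := le_tsub_add
  exact_mod_cast EReal.coe_ennreal_le_coe_ennreal_iff.2 h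

section Product

variable {X Y : Type*} [MeasurableSpace X] [MeasurableSpace Y] [StandardBorelSpace Y] [Nonempty Y]

theorem ae_condKernel_ac {μ : Measure Y} [IsProbabilityMeasure μ] {l : Measure X}
    [IsProbabilityMeasure l] {ρ : Measure (X × Y)} [IsProbabilityMeasure ρ] (h : ρ ≪ l.prod μ) :
    ρ.fst ≪ l ∧ ∀ᵐ x ∂ρ.fst, ρ.condKernel x ≪ μ := by
  rw [← Measure.compProd_const, ← ρ.disintegrate ρ.condKernel] at h
  have h1 := Measure.absolutelyContinuous_of_compProd h
  have h2 := h.kernel_of_compProd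
  simp only [Kernel.const_apply] at h1 h2
  exact ⟨h1, h2⟩

theorem rnDeriv_prod_ae_eq [MeasurableSpace.CountableOrCountablyGenerated X Y]
    {μ : Measure Y} [IsProbabilityMeasure μ] {l : Measure X}
    [IsProbabilityMeasure l] {ρ : Measure (X × Y)} [IsProbabilityMeasure ρ] (h : ρ ≪ l.prod μ) :
    ρ.rnDeriv (l.prod μ) =ᵐ[l.prod μ]
      fun z => ρ.fst.rnDeriv l z.1 * ρ.condKernel.rnDeriv (Kernel.const X μ) z.1 z.2 := by
  obtain ⟨h1, h2⟩ := ae_condKernel_ac h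
  have hκ : ρ.condKernel =ᵐ[ρ.fst]
      (Kernel.const X μ).withDensity (ρ.condKernel.rnDeriv (Kernel.const X μ)) := by
    filter_upwards [h2] with x hx
    exact (Kernel.withDensity_rnDeriv_eq (by simpa using hx)).symm
  have hρ : ρ = (l.prod μ).withDensity
      (fun z => ρ.fst.rnDeriv l z.1 * ρ.condKernel.rnDeriv (Kernel.const X μ) z.1 z.2) := by
    conv_lhs => rw [← ρ.disintegrate ρ.condKernel, Measure.compProd_congr hκ,
      Measure.compProd_withDensity (by fun_prop), Measure.compProd_const]
    conv_lhs => rw [← Measure.withDensity_rnDeriv_eq _ _ h1, prod_withDensity_left (by fun_prop)]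
    exact (withDensity_mul _ (by fun_prop) (by fun_prop)).symm
  conv_lhs => rw [hρ]
  exact Measure.rnDeriv_withDensity _ (by fun_prop)

theorem ae_condKernel_rnDeriv [MeasurableSpace.CountableOrCountablyGenerated X Y]
    {μ : Measure Y} [IsProbabilityMeasure μ] {l : Measure X}
    [IsProbabilityMeasure l] {ρ : Measure (X × Y)} [IsProbabilityMeasure ρ] (h : ρ ≪ l.prod μ)
    (p : ℝ≥0∞) :
    ∀ᵐ x ∂ρ.fst,
      extend (lpAlpha μ p) (ρ.condKernel x) ≤
        ((eLpNorm (ρ.condKernel.rnDeriv (Kernel.const X μ) x) p μ - 1 : ℝ≥0∞) : EReal) ∧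
      ∫⁻ y, ρ.condKernel.rnDeriv (Kernel.const X μ) x y ∂μ = 1 := by
  filter_upwards [(ae_condKernel_ac h).2] with x hx
  constructor
  · have hR : ρ.condKernel.rnDeriv (Kernel.const X μ) x =ᵐ[μ] (ρ.condKernel x).rnDeriv μ := by
      simpa using Kernel.rnDeriv_eq_rnDeriv_measure (κ := ρ.condKernel) (η := Kernel.const X μ)
        (a := x)
    rw [eLpNorm_congr_ae hR]
    exact extend_lpAlpha_le hx p
  · have := Kernel.lintegral_rnDeriv (κ := ρ.condKernel) (η := Kernel.const X μ) (a := x)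
      (by simpa using hx)
    simpa using this

/-- Both factors of the disintegrated density, evaluated almost everywhere for `l`. -/
theorem ae_lintegral_rnDeriv_condKernel [MeasurableSpace.CountableOrCountablyGenerated X Y]
    {μ : Measure Y} [IsProbabilityMeasure μ] {l : Measure X}
    [IsProbabilityMeasure l] {ρ : Measure (X × Y)} [IsProbabilityMeasure ρ] (h : ρ ≪ l.prod μ) :
    ∀ᵐ x ∂l, ρ.fst.rnDeriv l x ≠ 0 →
      ∫⁻ y, ρ.condKernel.rnDeriv (Kernel.const X μ) x y ∂μ = 1 := by
  rw [← ae_withDensity_iff (by fun_prop), Measure.withDensity_rnDeriv_eq _ _ (ae_condKernel_ac h).1]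
  exact (ae_condKernel_rnDeriv h 1).mono fun x hx => hx.2

theorem exists_lpAlpha_bound_top [MeasurableSpace.CountableOrCountablyGenerated X Y]
    {μ : Measure Y} [IsProbabilityMeasure μ] {l : Measure X}
    [IsProbabilityMeasure l] {ρ : Measure (X × Y)} [IsProbabilityMeasure ρ] (h : ρ ≪ l.prod μ) :
    ∃ G : X → ℝ≥0∞, Measurable G ∧
      (∀ᵐ x ∂ρ.fst, extend (lpAlpha μ ⊤) (ρ.condKernel x) ≤ (G x : EReal)) ∧
      ∫⁻ x, G x ∂ρ.fst ≤ eLpNorm (ρ.rnDeriv (l.prod μ)) ⊤ (l.prod μ) ∧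
      eLpNorm (ρ.fst.rnDeriv l) ⊤ l ≤ eLpNorm (ρ.rnDeriv (l.prod μ)) ⊤ (l.prod μ) := by
  set C := eLpNorm (ρ.rnDeriv (l.prod μ)) ⊤ (l.prod μ) with hC
  have hfst := (ae_condKernel_ac h).1
  have hbound : ∀ᵐ x ∂l, ∀ᵐ y ∂μ,
      ρ.fst.rnDeriv l x * ρ.condKernel.rnDeriv (Kernel.const X μ) x y ≤ C := by
    refine Measure.ae_ae_of_ae_prod (p := fun z : X × Y =>
      ρ.fst.rnDeriv l z.1 * ρ.condKernel.rnDeriv (Kernel.const X μ) z.1 z.2 ≤ C) ?_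
    filter_upwards [rnDeriv_prod_ae_eq h, ae_le_eLpNormEssSup (f := ρ.rnDeriv (l.prod μ))
      (μ := l.prod μ)] with z hz hz'
    rw [← hz, hC, eLpNorm_exponent_top]
    simpa using hz'
  refine ⟨fun x => C / ρ.fst.rnDeriv l x, by fun_prop, ?_, ?_, ?_⟩
  · filter_upwards [ae_condKernel_rnDeriv h ⊤, hfst.ae_le hbound, Measure.rnDeriv_pos hfst,
      hfst.ae_le (ρ.fst.rnDeriv_lt_top l)] with x hx hb h0 ht
    refine hx.1.trans (EReal.coe_ennreal_le_coe_ennreal_iff.2 (tsub_le_self.trans ?_))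
    rw [eLpNorm_exponent_top]
    refine essSup_le_of_ae_le _ ?_
    filter_upwards [hb] with y hy
    rw [enorm_eq_self, ENNReal.le_div_iff_mul_le (.inl h0.ne') (.inl ht.ne), mul_comm]
    exact hy
  · calc ∫⁻ x, C / ρ.fst.rnDeriv l x ∂ρ.fst
        = ∫⁻ x, ρ.fst.rnDeriv l x * (C / ρ.fst.rnDeriv l x) ∂l :=
          (lintegral_rnDeriv_mul hfst (by fun_prop)).symm
      _ ≤ ∫⁻ _, C ∂l := lintegral_mono fun x => ENNReal.mul_div_le
      _ = C := by simp
  · rw [eLpNorm_exponent_top]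
    refine essSup_le_of_ae_le _ ?_
    filter_upwards [hbound, ae_lintegral_rnDeriv_condKernel h] with x hb hx
    rw [enorm_eq_self]
    by_cases h0 : ρ.fst.rnDeriv l x = 0
    · simp [h0]
    calc ρ.fst.rnDeriv l x
        = ∫⁻ y, ρ.fst.rnDeriv l x * ρ.condKernel.rnDeriv (Kernel.const X μ) x y ∂μ := by
          rw [lintegral_const_mul _ (by fun_prop), hx h0, mul_one]
      _ ≤ ∫⁻ _, C ∂μ := lintegral_mono_ae hb
      _ = C := by simp

theorem eLpNorm_rpow_toReal {Z : Type*} [MeasurableSpace Z] {m : Measure Z} {p : ℝ≥0∞}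
    (hp0 : p ≠ 0) (hp : p ≠ ⊤) (f : Z → ℝ≥0∞) :
    eLpNorm f p m ^ p.toReal = ∫⁻ z, f z ^ p.toReal ∂m := by
  rw [eLpNorm_eq_lintegral_rpow_enorm_toReal hp0 hp, ← ENNReal.rpow_mul,
    one_div_mul_cancel (ENNReal.toReal_pos hp0 hp).ne', ENNReal.rpow_one]
  simp

theorem exists_lpAlpha_bound [MeasurableSpace.CountableOrCountablyGenerated X Y]
    {p : ℝ≥0∞} (hp1 : 1 < p) (hp : p ≠ ⊤)
    {μ : Measure Y} [IsProbabilityMeasure μ] {l : Measure X}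
    [IsProbabilityMeasure l] {ρ : Measure (X × Y)} [IsProbabilityMeasure ρ] (h : ρ ≪ l.prod μ) :
    ∃ G : X → ℝ≥0∞, Measurable G ∧
      (∀ᵐ x ∂ρ.fst, extend (lpAlpha μ p) (ρ.condKernel x) ≤ (G x : EReal)) ∧
      (∫⁻ x, G x ∂ρ.fst) ^ p.toReal + eLpNorm (ρ.fst.rnDeriv l) p l ^ p.toReal ≤
        eLpNorm (ρ.rnDeriv (l.prod μ)) p (l.prod μ) ^ p.toReal := by
  have hp0 : p ≠ 0 := (zero_lt_one.trans hp1).ne'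
  have hr0 : 0 ≤ p.toReal := ENNReal.toReal_nonneg
  have hr1 : 1 ≤ p.toReal := by
    rw [← ENNReal.toReal_one]; exact ENNReal.toReal_mono hp hp1.le
  have hfst := (ae_condKernel_ac h).1
  set R : X → Y → ℝ≥0∞ := ρ.condKernel.rnDeriv (Kernel.const X μ) with hR
  have hRm : Measurable (fun z : X × Y => R z.1 z.2) := Kernel.measurable_rnDeriv _ _
  set f := ρ.fst.rnDeriv l with hf
  have hfm : Measurable f := Measure.measurable_rnDeriv _ _
  have hN : Measurable fun x => eLpNorm (R x) p μ := by
    simp_rw [eLpNorm_eq_lintegral_rpow_enorm_toReal hp0 hp, enorm_eq_self]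
    exact (Measurable.lintegral_prod_right' (f := fun z : X × Y => R z.1 z.2 ^ p.toReal)
      (hRm.pow_const _)).pow_const _
  refine ⟨fun x => eLpNorm (R x) p μ - 1, hN.sub_const _,
    (ae_condKernel_rnDeriv h p).mono fun x hx => hx.1, ?_⟩
  have hA : (∫⁻ x, (eLpNorm (R x) p μ - 1) ∂ρ.fst) ^ p.toReal ≤
      ∫⁻ x, (f x * (eLpNorm (R x) p μ - 1)) ^ p.toReal ∂l := by
    rw [← eLpNorm_rpow_toReal hp0 hp]
    refine ENNReal.rpow_le_rpow ?_ hr0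
    rw [← lintegral_rnDeriv_mul hfst (hN.sub_const _).aemeasurable]
    calc _ = eLpNorm (fun x => f x * (eLpNorm (R x) p μ - 1)) 1 l := by
          rw [eLpNorm_one_eq_lintegral_enorm]; simp [hf]
      _ ≤ _ := eLpNorm_le_eLpNorm_of_exponent_le hp1.le
          (hfm.mul (hN.sub_const _)).aestronglyMeasurable
  have hfR : Measurable (fun z : X × Y => f z.1 * R z.1 z.2) :=
    (hfm.comp measurable_fst).mul hRm
  rw [eLpNorm_congr_ae (rnDeriv_prod_ae_eq h), eLpNorm_rpow_toReal hp0 hp,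
    eLpNorm_rpow_toReal hp0 hp, lintegral_prod _ (hfR.pow_const _).aemeasurable]
  refine (add_le_add_left hA _).trans ?_
  rw [← lintegral_add_right _ (hfm.pow_const _)]
  refine lintegral_mono_ae ?_
  filter_upwards [ae_lintegral_rnDeriv_condKernel h] with x hx
  have hRx : Measurable (R x) := hRm.comp measurable_prodMk_left
  change (f x * (eLpNorm (R x) p μ - 1)) ^ p.toReal + f x ^ p.toReal ≤
    ∫⁻ y, (f x * R x y) ^ p.toReal ∂μ
  simp_rw [ENNReal.mul_rpow_of_nonneg _ _ hr0]
  rw [lintegral_const_mul _ (hRx.pow_const _), ← eLpNorm_rpow_toReal hp0 hp]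
  by_cases h0 : f x = 0
  · simp [h0, (zero_lt_one.trans_le hr1)]
  have h1 : 1 ≤ eLpNorm (R x) p μ := by
    calc (1 : ℝ≥0∞) = eLpNorm (R x) 1 μ := by
          rw [eLpNorm_one_eq_lintegral_enorm]; simp [← hx h0, hR]
      _ ≤ _ := eLpNorm_le_eLpNorm_of_exponent_le hp1.le hRx.aestronglyMeasurable
  calc _ = f x ^ p.toReal * ((eLpNorm (R x) p μ - 1) ^ p.toReal + 1 ^ p.toReal) := by
        rw [ENNReal.one_rpow, mul_add, mul_one]
    _ ≤ f x ^ p.toReal * (eLpNorm (R x) p μ - 1 + 1) ^ p.toReal := by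
        gcongr; exact ENNReal.add_rpow_le_rpow_add _ _ hr1
    _ = _ := by rw [tsub_add_cancel_of_le h1]

end Product

theorem eLpNorm_rnDeriv_map_equiv {X Y : Type*} [MeasurableSpace X] [MeasurableSpace Y]
    (e : X ≃ᵐ Y) (a b : Measure X) [SigmaFinite a] [SigmaFinite b] (p : ℝ≥0∞) :
    eLpNorm ((a.map e).rnDeriv (b.map e)) p (b.map e) = eLpNorm (a.rnDeriv b) p b := by
  rw [e.measurableEmbedding.eLpNorm_map_measure]
  exact eLpNorm_congr_ae (e.measurableEmbedding.rnDeriv_map a b)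

section InitialCoordinates

variable {E : Type*} [MeasurableSpace E]

/-- The first `k` coordinates of a point of `E^n`. -/
def headMap {k n : ℕ} (h : k ≤ n) (x : Fin n → E) : Fin k → E := fun i => x (Fin.castLE h i)

theorem measurable_headMap {k n : ℕ} (h : k ≤ n) :
    Measurable (headMap (E := E) h) :=
  measurable_pi_lambda _ fun _ => measurable_pi_apply _

theorem map_headMap_pi (μ : Measure E) [IsProbabilityMeasure μ] {k n : ℕ} (h : k ≤ n) :
    (Measure.pi fun _ : Fin n => μ).map (headMap h) = Measure.pi fun _ : Fin k => μ := by
  have hi : iIndepFun (fun (i : Fin n) (x : Fin n → E) => x i) (Measure.pi fun _ => μ) :=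
    iIndepFun_pi (X := fun _ => id) fun _ => aemeasurable_id
  have := (hi.precomp (Fin.castLE_injective h)).map_fun_eq_pi_map
    fun i => (measurable_pi_apply _).aemeasurable
  simp only [(measurePreserving_eval (fun _ : Fin n => μ) _).map_eq] at this
  exact this

/-- Splitting off the last coordinate. -/
def splitLast (E : Type*) [MeasurableSpace E] (k : ℕ) : (Fin (k + 1) → E) ≃ᵐ (Fin k → E) × E :=
  (MeasurableEquiv.piFinSuccAbove (fun _ => E) (Fin.last k)).trans MeasurableEquiv.prodComm

theorem splitLast_apply {k : ℕ} (x : Fin (k + 1) → E) :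
    splitLast E k x = (fun i => x i.castSucc, x (Fin.last k)) := by
  refine Prod.ext ?_ rfl
  funext i
  exact congrArg x (by simp)

theorem map_splitLast_pi (μ : Measure E) [IsProbabilityMeasure μ] (k : ℕ) :
    (Measure.pi fun _ : Fin (k + 1) => μ).map (splitLast E k) =
      (Measure.pi fun _ : Fin k => μ).prod μ :=
  (Measure.measurePreserving_swap.comp
    (measurePreserving_piFinSuccAbove (fun _ : Fin (k + 1) => μ) (Fin.last k))).map_eq

theorem map_splitLast_map_headMap {n : ℕ} (ν : Measure (Fin n → E)) (k : Fin n) :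
    (ν.map (headMap k.isLt)).map (splitLast E k) =
      ν.map fun x => (headMap k.isLt.le x, x k) := by
  rw [Measure.map_map (MeasurableEquiv.measurable _) (measurable_headMap _)]
  congr 1
  funext x
  rw [Function.comp_apply, splitLast_apply]
  rfl

/-- The `L^p` norm of the density of the law of the first `k` coordinates. -/
def headNorm (μ : Measure E) (p : ℝ≥0∞) {n : ℕ} (ν : Measure (Fin n → E)) {k : ℕ}
    (h : k ≤ n) : ℝ≥0∞ :=
  eLpNorm ((ν.map (headMap h)).rnDeriv (Measure.pi fun _ => μ)) p (Measure.pi fun _ => μ)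

theorem headNorm_self (μ : Measure E) (p : ℝ≥0∞) {n : ℕ} (ν : Measure (Fin n → E)) :
    headNorm μ p ν le_rfl =
      eLpNorm (ν.rnDeriv (Measure.pi fun _ => μ)) p (Measure.pi fun _ => μ) := by
  have : headMap (E := E) (le_refl n) = id := rfl
  rw [headNorm, this, Measure.map_id]

theorem headNorm_succ (μ : Measure E) [IsProbabilityMeasure μ] (p : ℝ≥0∞) {n : ℕ}
    (ν : Measure (Fin n → E)) [IsProbabilityMeasure ν] (k : Fin n) :
    headNorm μ p ν k.isLt =
      eLpNorm ((ν.map fun x => (headMap k.isLt.le x, x k)).rnDeriv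
        ((Measure.pi fun _ : Fin k => μ).prod μ)) p ((Measure.pi fun _ : Fin k => μ).prod μ) := by
  have := Measure.isProbabilityMeasure_map (μ := ν)
    (measurable_headMap (E := E) k.isLt).aemeasurable
  rw [← map_splitLast_map_headMap, ← map_splitLast_pi, eLpNorm_rnDeriv_map_equiv]
  rfl

theorem map_pair_ac {μ : Measure E} [IsProbabilityMeasure μ] {n : ℕ}
    {ν : Measure (Fin n → E)} (hac : ν ≪ Measure.pi fun _ => μ) (k : Fin n) :
    (ν.map fun x => (headMap k.isLt.le x, x k)) ≪ (Measure.pi fun _ : Fin k => μ).prod μ := by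
  rw [← map_splitLast_map_headMap, ← map_splitLast_pi, ← map_headMap_pi μ k.isLt]
  exact (hac.map (measurable_headMap _)).map (MeasurableEquiv.measurable _)

theorem measurable_pair {n : ℕ} (k : Fin n) :
    Measurable fun x : Fin n → E => (headMap k.isLt.le x, x k) :=
  (measurable_headMap _).prodMk (measurable_pi_apply _)

theorem fst_map_pair {n : ℕ} (ν : Measure (Fin n → E)) (k : Fin n) :
    (ν.map fun x => (headMap k.isLt.le x, x k)).fst = ν.map (headMap k.isLt.le) := by
  rw [Measure.fst, Measure.map_map measurable_fst (measurable_pair k)]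
  rfl

variable [TopologicalSpace E] [PolishSpace E] [BorelSpace E] [Nonempty E]

theorem erealIntegral_condLaw_le (α : ProbabilityMeasure E → EReal) {n : ℕ}
    (ν : ProbabilityMeasure (Fin n → E)) (k : Fin n) {G : (Fin k → E) → ℝ≥0∞} (hG : Measurable G)
    (h : ∀ᵐ y ∂(ν : Measure (Fin n → E)).map (headMap k.isLt.le),
      extend α (condLaw n ν k y) ≤ (G y : EReal)) :
    erealIntegral (ν : Measure (Fin n → E))
      (fun x => extend α (condLaw n ν k (headMap k.isLt.le x))) ≤
      ((∫⁻ y, G y ∂(ν : Measure (Fin n → E)).map (headMap k.isLt.le) : ℝ≥0∞) : EReal) := by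
  rw [lintegral_map hG (measurable_headMap _)]
  exact erealIntegral_le_lintegral
    (ae_of_ae_map (measurable_headMap _).aemeasurable h)

theorem alphan_le_sum (α : ProbabilityMeasure E → EReal) {n : ℕ}
    (ν : ProbabilityMeasure (Fin n → E)) {a : Fin n → ℝ≥0∞}
    (h : ∀ k : Fin n, ∃ G : (Fin k → E) → ℝ≥0∞, Measurable G ∧
      (∀ᵐ y ∂(ν : Measure (Fin n → E)).map (headMap k.isLt.le),
        extend α (condLaw n ν k y) ≤ (G y : EReal)) ∧
      ∫⁻ y, G y ∂(ν : Measure (Fin n → E)).map (headMap k.isLt.le) = a k) :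
    alphan α n ν ≤ ((∑ k, a k : ℝ≥0∞) : EReal) := by
  rw [coe_finset_sum]
  refine Finset.sum_le_sum fun k _ => ?_
  obtain ⟨G, hG, hle, hk⟩ := h k
  rw [← hk]
  exact erealIntegral_condLaw_le α ν k hG hle

theorem alphan_top_le {μ : Measure E} [IsProbabilityMeasure μ] {n : ℕ}
    {ν : ProbabilityMeasure (Fin n → E)}
    (hac : (ν : Measure (Fin n → E)) ≪ Measure.pi fun _ => μ) :
    alphan (lpAlpha μ ⊤) n ν ≤
      ((n * headNorm μ ⊤ (ν : Measure (Fin n → E)) le_rfl : ℝ≥0∞) : EReal) := by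
  have hstep (k : Fin n) : ∃ G : (Fin k → E) → ℝ≥0∞, Measurable G ∧
      (∀ᵐ y ∂(ν : Measure (Fin n → E)).map (headMap k.isLt.le),
        extend (lpAlpha μ ⊤) (condLaw n ν k y) ≤ (G y : EReal)) ∧
      ∫⁻ y, G y ∂(ν : Measure (Fin n → E)).map (headMap k.isLt.le) ≤
        headNorm μ ⊤ (ν : Measure (Fin n → E)) k.isLt ∧
      headNorm μ ⊤ (ν : Measure (Fin n → E)) k.isLt.le ≤
        headNorm μ ⊤ (ν : Measure (Fin n → E)) k.isLt := by
    have := Measure.isProbabilityMeasure_map (μ := (ν : Measure (Fin n → E)))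
      (measurable_pair k).aemeasurable
    have h := exists_lpAlpha_bound_top (map_pair_ac hac k)
    rwa [fst_map_pair, ← headNorm_succ] at h
  have hmono {k : ℕ} (hk : k ≤ n) : headNorm μ ⊤ (ν : Measure (Fin n → E)) hk ≤
      headNorm μ ⊤ (ν : Measure (Fin n → E)) le_rfl := by
    induction hk using Nat.decreasingInduction with
    | self => exact le_rfl
    | of_succ k hk ih => exact (hstep ⟨k, hk⟩).choose_spec.2.2.2.trans ih
  choose G hG hle hint _ using hstep
  refine (alphan_le_sum _ ν fun k => ⟨G k, hG k, hle k, rfl⟩).trans ?_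
  rw [EReal.coe_ennreal_le_coe_ennreal_iff]
  calc _ ≤ ∑ _ : Fin n, headNorm μ ⊤ (ν : Measure (Fin n → E)) le_rfl :=
        Finset.sum_le_sum fun k _ => (hint k).trans (hmono _)
    _ = _ := by simp

theorem alphan_le_of_ne_top {p : ℝ≥0∞} (hp1 : 1 < p) (hp : p ≠ ⊤)
    {μ : Measure E} [IsProbabilityMeasure μ] {n : ℕ} {ν : ProbabilityMeasure (Fin n → E)}
    (hac : (ν : Measure (Fin n → E)) ≪ Measure.pi fun _ => μ) :
    alphan (lpAlpha μ p) n ν ≤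
      (((n : ℝ≥0∞) ^ (1 - 1 / p.toReal) *
        headNorm μ p (ν : Measure (Fin n → E)) le_rfl : ℝ≥0∞) : EReal) := by
  have hr1 : 1 ≤ p.toReal := by
    rw [← ENNReal.toReal_one]; exact ENNReal.toReal_mono hp hp1.le
  have hr0 : 0 < p.toReal := zero_lt_one.trans_le hr1
  have hstep (k : Fin n) : ∃ G : (Fin k → E) → ℝ≥0∞, Measurable G ∧
      (∀ᵐ y ∂(ν : Measure (Fin n → E)).map (headMap k.isLt.le),
        extend (lpAlpha μ p) (condLaw n ν k y) ≤ (G y : EReal)) ∧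
      (∫⁻ y, G y ∂(ν : Measure (Fin n → E)).map (headMap k.isLt.le)) ^ p.toReal +
        headNorm μ p (ν : Measure (Fin n → E)) k.isLt.le ^ p.toReal ≤
        headNorm μ p (ν : Measure (Fin n → E)) k.isLt ^ p.toReal := by
    have := Measure.isProbabilityMeasure_map (μ := (ν : Measure (Fin n → E)))
      (measurable_pair k).aemeasurable
    have h := exists_lpAlpha_bound hp1 hp (map_pair_ac hac k)
    rwa [fst_map_pair, ← headNorm_succ] at h
  choose G hG hle hint using hstep
  set a : Fin n → ℝ≥0∞ := fun k =>
    ∫⁻ y, G k y ∂(ν : Measure (Fin n → E)).map (headMap k.isLt.le)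
  have htel (k : ℕ) (hk : k ≤ n) : ∑ i : Fin k, a (Fin.castLE hk i) ^ p.toReal ≤
      headNorm μ p (ν : Measure (Fin n → E)) hk ^ p.toReal := by
    induction k with
    | zero => simp
    | succ k ih =>
      rw [Fin.sum_univ_castSucc, add_comm]
      exact (add_le_add_right (ih (Nat.le_of_succ_le hk)) _).trans (hint ⟨k, hk⟩)
  refine (alphan_le_sum _ ν fun k => ⟨G k, hG k, hle k, rfl⟩).trans ?_
  rw [EReal.coe_ennreal_le_coe_ennreal_iff, ← ENNReal.rpow_le_rpow_iff hr0,
    ENNReal.mul_rpow_of_nonneg _ _ hr0.le, ← ENNReal.rpow_mul, sub_mul,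
    one_div_mul_cancel hr0.ne', one_mul]
  refine (ENNReal.rpow_sum_le_const_mul_sum_rpow Finset.univ a hr1).trans ?_
  rw [Finset.card_univ, Fintype.card_fin]
  exact mul_le_mul_right (htel n le_rfl) _

end InitialCoordinates

/-- **Lemma 4.4**: `α_n(ν) ≤ n^{1/q} ‖dν/dμ^n‖_{L^p(μ^n)}` for `ν ≪ μ^n`. -/
theorem lp_alphan_bound
    {E : Type*} [MeasurableSpace E] [TopologicalSpace E] [PolishSpace E] [BorelSpace E]
    [Nonempty E]
    (p q : ℝ≥0∞) (hp : 1 < p) (hq : 1 / p + 1 / q = 1)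
    (μ : Measure E) [IsProbabilityMeasure μ]
    (n : ℕ) (hn : 1 ≤ n) (ν : ProbabilityMeasure (Fin n → E))
    (hac : (ν : Measure (Fin n → E)) ≪ Measure.pi (fun _ : Fin n => μ)) :
    alphan (lpAlpha μ p) n ν ≤
      (((n : ℝ≥0∞) ^ (1 / q).toReal *
        eLpNorm (fun x => ((ν : Measure (Fin n → E)).rnDeriv (Measure.pi fun _ => μ) x).toReal)
          p (Measure.pi fun _ : Fin n => μ) : ℝ≥0∞) : EReal) := by
  rw [eLpNorm_toReal_of_lt_top (Measure.rnDeriv_lt_top _ _), ← headNorm_self]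
  obtain rfl | hp' := eq_or_ne p ⊤
  · have hq1 : 1 / q = 1 := by simpa using hq
    rw [hq1, ENNReal.toReal_one, ENNReal.rpow_one]
    exact alphan_top_le hac
  · have hp0 : p ≠ 0 := (zero_lt_one.trans hp).ne'
    have hq' : (1 / q).toReal = 1 - 1 / p.toReal := by
      have h : (1 / p).toReal + (1 / q).toReal = 1 := by
        rw [← ENNReal.toReal_add _ _, hq, ENNReal.toReal_one]
        · simpa using hp0
        · exact ne_top_of_le_ne_top ENNReal.one_ne_top (le_add_self.trans hq.le)
      rw [ENNReal.toReal_div, ENNReal.toReal_one] at h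
      linarith
    rw [hq']
    exact alphan_le_of_ne_top hp hp' hac

end SanovDual
end
end

section
/- Let X be a compact Polish space, E a Polish space, q ∈ (1,∞), and h : X × E → ℝ jointly continuous, bounded from below, with compact sub-level sets. Let μ ∈ P(E) satisfy ∫_E ψ^q dμ < ∞, where ψ(w) = (sup_{x ∈ X} h(x,w))^+. Define V(ν) = inf_{x ∈ X} ∫_E h(x,w) ν(dw). Then for every ε > 0, limsup_{n→∞} n^{q−1} μ^n( |V(L_n) − V(μ)| ≥ ε ) < ∞. -/
open MeasureTheory ProbabilityTheory Filter Topology Set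
open scoped ENNReal NNReal

noncomputable section

namespace SanovDual

attribute [local instance] Classical.propDecidable

/-- A second-order upper bound for the exponential by a power of exponent `p ∈ [1, 2]`. -/
theorem exp_le_one_add_add_rpow_mul_exp {p u M : ℝ} (hp1 : 1 ≤ p) (hp2 : p ≤ 2) (hM : 0 ≤ M)
    (hu : u ≤ M) : Real.exp u ≤ 1 + u + |u| ^ p * Real.exp M := by
  have hM1 : 1 ≤ Real.exp M := Real.one_le_exp hM
  rcases le_or_gt |u| 1 with h1 | h1
  · have h2 := le_of_abs_le (Real.abs_exp_sub_one_sub_id_le h1)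
    have h3 : u ^ 2 ≤ |u| ^ p := by
      rw [← sq_abs, ← Real.rpow_two]
      rcases (abs_nonneg u).eq_or_lt with h0 | h0
      · rw [← h0, Real.zero_rpow (by norm_num), Real.zero_rpow (by linarith)]
      · exact Real.rpow_le_rpow_of_exponent_ge h0 h1 hp2
    nlinarith [Real.rpow_nonneg (abs_nonneg u) p]
  · have h2 : |u| ≤ |u| ^ p := by
      simpa using Real.rpow_le_rpow_of_exponent_le h1.le hp1
    rcases le_total 0 u with h0 | h0
    · rw [abs_of_nonneg h0] at *
      have := Real.exp_le_exp.2 hu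
      nlinarith
    · rw [abs_of_nonpos h0] at *
      have : Real.exp u ≤ 1 := Real.exp_le_one_iff.2 h0
      nlinarith

/-- An upper bound for the Laplace transform of a centered random variable truncated from above. -/
theorem integral_exp_mul_min_le {Ω : Type*} [MeasurableSpace Ω] {μ : Measure Ω}
    [IsProbabilityMeasure μ] {p l b : ℝ} (hp1 : 1 ≤ p) (hp2 : p ≤ 2) (hl : 0 ≤ l) (hb : 0 ≤ b)
    {Z : Ω → ℝ} (hZ : Measurable Z) (hZint : Integrable Z μ) (hmean : ∫ ω, Z ω ∂μ = 0)
    (hZp : Integrable (fun ω => |Z ω| ^ p) μ) :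
    Integrable (fun ω => Real.exp (l * min (Z ω) b)) μ ∧
      ∫ ω, Real.exp (l * min (Z ω) b) ∂μ ≤
        Real.exp (l ^ p * Real.exp (l * b) * ∫ ω, |Z ω| ^ p ∂μ) := by
  have hexp : Integrable (fun ω => Real.exp (l * min (Z ω) b)) μ := by
    refine Integrable.of_bound (C := Real.exp (l * b))
      (by fun_prop : Measurable fun ω => Real.exp (l * min (Z ω) b)).aestronglyMeasurable
      (Eventually.of_forall fun ω => ?_)
    rw [Real.norm_eq_abs, Real.abs_exp]
    gcongr
    exact min_le_right _ _
  refine ⟨hexp, ?_⟩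
  have hbound : ∀ ω, Real.exp (l * min (Z ω) b) ≤
      1 + l * Z ω + l ^ p * Real.exp (l * b) * |Z ω| ^ p := by
    intro ω
    have hmin : l * min (Z ω) b ≤ l * b := by gcongr; exact min_le_right _ _
    have hZmin : l * min (Z ω) b ≤ l * Z ω := by gcongr; exact min_le_left _ _
    have habs : |min (Z ω) b| ≤ |Z ω| := by
      rcases le_total (Z ω) b with h | h
      · rw [min_eq_left h]
      · rw [min_eq_right h, abs_of_nonneg hb]
        exact h.trans (le_abs_self _)
    have h1 := exp_le_one_add_add_rpow_mul_exp hp1 hp2 (mul_nonneg hl hb) hmin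
    have h2 : |l * min (Z ω) b| ^ p ≤ l ^ p * |Z ω| ^ p := by
      rw [abs_mul, abs_of_nonneg hl, Real.mul_rpow hl (abs_nonneg _)]
      gcongr
    have h3 := mul_le_mul_of_nonneg_right h2 (Real.exp_nonneg (l * b))
    linarith
  have hint1 : Integrable (fun ω => 1 + l * Z ω) μ :=
    (integrable_const 1).add (hZint.const_mul l)
  calc ∫ ω, Real.exp (l * min (Z ω) b) ∂μ
      ≤ ∫ ω, (1 + l * Z ω + l ^ p * Real.exp (l * b) * |Z ω| ^ p) ∂μ :=
        integral_mono hexp (hint1.add (hZp.const_mul _)) hbound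
    _ = l ^ p * Real.exp (l * b) * ∫ ω, |Z ω| ^ p ∂μ + 1 := by
        rw [integral_add hint1 (hZp.const_mul _), integral_add (integrable_const 1)
          (hZint.const_mul l), integral_const_mul, integral_const_mul, hmean]
        simp [add_comm]
    _ ≤ _ := Real.add_one_le_exp _

/-- A Fuk–Nagaev type inequality for sums of independent copies of a centered random variable. -/
theorem measureReal_pi_le_sum_le {Ω : Type*} [MeasurableSpace Ω] {μ : Measure Ω}
    [IsProbabilityMeasure μ] {p q l b : ℝ} (hp1 : 1 ≤ p) (hp2 : p ≤ 2) (hq : 0 < q) (hl : 0 ≤ l)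
    (hb : 0 < b) {Z : Ω → ℝ} (hZ : Measurable Z) (hZint : Integrable Z μ)
    (hmean : ∫ ω, Z ω ∂μ = 0) (hZp : Integrable (fun ω => |Z ω| ^ p) μ)
    (hZq : Integrable (fun ω => |Z ω| ^ q) μ) (n : ℕ) (t : ℝ) :
    (Measure.pi fun _ : Fin n => μ).real {w | t ≤ ∑ i, Z (w i)} ≤
      n * ((∫ ω, |Z ω| ^ q ∂μ) / b ^ q) +
        Real.exp (-l * t + n * (l ^ p * Real.exp (l * b) * ∫ ω, |Z ω| ^ p ∂μ)) := by
  set P := Measure.pi fun _ : Fin n => μ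
  obtain ⟨hexp, hmgf⟩ := integral_exp_mul_min_le hp1 hp2 hl hb.le hZ hZint hmean hZp
  have hbq : 0 < b ^ q := Real.rpow_pos_of_pos hb q
  have hlarge : ∀ i : Fin n, P.real {w | b < Z (w i)} ≤ (∫ ω, |Z ω| ^ q ∂μ) / b ^ q := by
    intro i
    have hpre : P.real {w | b < Z (w i)} = μ.real {ω | b < Z ω} :=
      (measurePreserving_eval (fun _ : Fin n => μ) i).measureReal_preimage
        (measurableSet_lt measurable_const hZ).nullMeasurableSet
    rw [hpre, le_div_iff₀ hbq, mul_comm]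
    refine le_trans ?_ (mul_meas_ge_le_integral_of_nonneg
      (Eventually.of_forall fun ω => Real.rpow_nonneg (abs_nonneg (Z ω)) q) hZq (b ^ q))
    refine mul_le_mul_of_nonneg_left (measureReal_mono ?_ (measure_ne_top _ _)) hbq.le
    intro ω hω
    exact Real.rpow_le_rpow hb.le (hω.out.le.trans (le_abs_self _)) hq.le
  have hprod : ∀ w : Fin n → Ω, Real.exp (l * ∑ i, min (Z (w i)) b) =
      ∏ i, Real.exp (l * min (Z (w i)) b) := fun w => by rw [Finset.mul_sum, Real.exp_sum]
  have hsmall : P.real {w | t ≤ ∑ i, min (Z (w i)) b} ≤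
      Real.exp (-l * t + n * (l ^ p * Real.exp (l * b) * ∫ ω, |Z ω| ^ p ∂μ)) := by
    refine (measure_ge_le_exp_mul_mgf (X := fun w : Fin n → Ω => ∑ i, min (Z (w i)) b) t hl
      ?_).trans ?_
    · simp_rw [hprod]
      exact Integrable.fintype_prod fun _ => hexp
    · rw [Real.exp_add, mgf]
      simp_rw [hprod]
      rw [integral_fintype_prod_eq_pow fun ω => Real.exp (l * min (Z ω) b),
        Fintype.card_fin, Real.exp_nat_mul]
      gcongr
  have hsub : {w : Fin n → Ω | t ≤ ∑ i, Z (w i)} ⊆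
      (⋃ i, {w | b < Z (w i)}) ∪ {w | t ≤ ∑ i, min (Z (w i)) b} := by
    intro w hw
    by_cases hbig : ∃ i, b < Z (w i)
    · exact Or.inl (mem_iUnion.2 hbig)
    · push Not at hbig
      right
      simpa only [mem_ofPred_eq, min_eq_left (hbig _)] using hw
  calc P.real {w | t ≤ ∑ i, Z (w i)} ≤ _ := measureReal_mono hsub (measure_ne_top _ _)
    _ ≤ _ := measureReal_union_le _ _
    _ ≤ _ := by
      gcongr
      refine (measureReal_iUnion_fintype_le _).trans
        ((Finset.sum_le_sum fun i _ => hlarge i).trans ?_)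
      simp

/-- The `n`-fold product probabilities of the sets `S n` are of order `n ^ (1 - q)`. -/
def RateBounded {Ω : Type*} [MeasurableSpace Ω] (μ : Measure Ω) (q : ℝ)
    (S : (n : ℕ) → Set (Fin n → Ω)) : Prop :=
  ∃ K : ℝ, ∀ᶠ n : ℕ in atTop, (n : ℝ) ^ (q - 1) * (Measure.pi fun _ : Fin n => μ).real (S n) ≤ K

theorem RateBounded.mono {Ω : Type*} [MeasurableSpace Ω] {μ : Measure Ω} [IsProbabilityMeasure μ]
    {q : ℝ} {S T : (n : ℕ) → Set (Fin n → Ω)} (hT : RateBounded μ q T)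
    (hST : ∀ᶠ n in atTop, S n ⊆ T n) : RateBounded μ q S := by
  obtain ⟨K, hK⟩ := hT
  refine ⟨K, ?_⟩
  filter_upwards [hK, hST] with n hn hsub
  refine le_trans ?_ hn
  gcongr
  exact measure_ne_top _ _

theorem RateBounded.union {Ω : Type*} [MeasurableSpace Ω] {μ : Measure Ω} {q : ℝ}
    {S T : (n : ℕ) → Set (Fin n → Ω)} (hS : RateBounded μ q S) (hT : RateBounded μ q T) :
    RateBounded μ q fun n => S n ∪ T n := by
  obtain ⟨K, hK⟩ := hS
  obtain ⟨L, hL⟩ := hT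
  refine ⟨K + L, ?_⟩
  filter_upwards [hK, hL] with n hn hn'
  refine le_trans ?_ (add_le_add hn hn')
  rw [← mul_add]
  gcongr
  exact measureReal_union_le _ _

theorem RateBounded.biUnion {Ω ι : Type*} [MeasurableSpace Ω] {μ : Measure Ω} {q : ℝ}
    {S : ι → (n : ℕ) → Set (Fin n → Ω)} (s : Finset ι) (hS : ∀ i ∈ s, RateBounded μ q (S i)) :
    RateBounded μ q fun n => ⋃ i ∈ s, S i n := by
  choose! K hK using hS
  refine ⟨∑ i ∈ s, K i, ?_⟩
  filter_upwards [(Filter.eventually_all_finset s).2 hK] with n hn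
  refine le_trans ?_ (Finset.sum_le_sum hn)
  rw [← Finset.mul_sum]
  gcongr
  exact measureReal_biUnion_finset_le _ _

theorem RateBounded.limsup_lt_top {Ω : Type*} [MeasurableSpace Ω] {μ : Measure Ω}
    [IsProbabilityMeasure μ] {q : ℝ} (hq : 1 ≤ q) {S : (n : ℕ) → Set (Fin n → Ω)}
    (hS : RateBounded μ q S) :
    limsup (fun n : ℕ => (n : ℝ≥0∞) ^ (q - 1) * (Measure.pi fun _ : Fin n => μ) (S n)) atTop
      < ⊤ := by
  obtain ⟨K, hK⟩ := hS
  refine lt_of_le_of_lt (limsup_le_of_le (a := ENNReal.ofReal K) (by isBoundedDefault) ?_)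
    ENNReal.ofReal_lt_top
  filter_upwards [hK] with n hn
  rw [← ofReal_measureReal, ← ENNReal.ofReal_natCast,
    ENNReal.ofReal_rpow_of_nonneg (Nat.cast_nonneg n) (by linarith),
    ← ENNReal.ofReal_mul (Real.rpow_nonneg (Nat.cast_nonneg n) _)]
  exact ENNReal.ofReal_le_ofReal hn

/-- Large deviations of the sample mean above the expectation for a centered random variable
with a moment of order `q`. -/
theorem rateBounded_le_sum {Ω : Type*} [MeasurableSpace Ω] {μ : Measure Ω}
    [IsProbabilityMeasure μ] {q ε : ℝ} (hq : 1 < q) (hε : 0 < ε) {Z : Ω → ℝ} (hZ : Measurable Z)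
    (hmean : ∫ ω, Z ω ∂μ = 0) (hZq : MemLp Z (ENNReal.ofReal q) μ) :
    RateBounded μ q fun n => {w | n * ε ≤ ∑ i, Z (w i)} := by
  have hpow : ∀ r : ℝ, 1 ≤ r → r ≤ q → Integrable (fun ω => |Z ω| ^ r) μ := by
    intro r hr hrq
    have := (hZq.mono_exponent (ENNReal.ofReal_le_ofReal hrq)).integrable_norm_rpow
      (by simpa using by linarith) ENNReal.ofReal_ne_top
    simpa [ENNReal.toReal_ofReal (zero_le_one.trans hr)] using this
  have hZint : Integrable Z μ := hZq.integrable (by simpa using hq.le)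
  set p := min q 2
  have hp1 : 1 < p := lt_min hq (by norm_num)
  have hZp := hpow p hp1.le (min_le_left _ _)
  have hZq' := hpow q hq.le le_rfl
  set A := ∫ ω, |Z ω| ^ q ∂μ
  set B := ∫ ω, |Z ω| ^ p ∂μ
  set a := (q - 1) / ε
  have ha : 0 < a := div_pos (by linarith) hε
  set c := (p - 1) / (2 * a)
  have hc : 0 < c := div_pos (by linarith) (by positivity)
  have hac : a * c = (p - 1) / 2 := by simp only [c]; field_simp
  have haε : a * ε = q - 1 := by simp only [a]; field_simp
  have hlog : Tendsto (fun n : ℕ => a ^ p * B * (Real.log n ^ p / (n : ℝ) ^ ((p - 1) / 2))) atTop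
      (𝓝 0) := by
    have h := (isLittleO_log_rpow_rpow_atTop p
      (by linarith : 0 < (p - 1) / 2)).tendsto_div_nhds_zero.comp tendsto_natCast_atTop_atTop
    simpa using h.const_mul (a ^ p * B)
  refine ⟨A / c ^ q + Real.exp 1, ?_⟩
  filter_upwards [hlog.eventually_le_const zero_lt_one, eventually_gt_atTop 0] with n hn hn0
  have hn' : (0 : ℝ) < n := Nat.cast_pos.2 hn0
  have hlogn : 0 ≤ Real.log n := Real.log_natCast_nonneg n
  have key := measureReal_pi_le_sum_le (μ := μ) (q := q) (l := a * Real.log n / n) (b := c * n)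
    hp1.le (min_le_right _ _) (by linarith) (by positivity) (by positivity) hZ hZint hmean hZp hZq'
    n (n * ε)
  have hpn : (0 : ℝ) < (n : ℝ) ^ (q - 1) := Real.rpow_pos_of_pos hn' _
  refine (mul_le_mul_of_nonneg_left key hpn.le).trans ?_
  rw [mul_add]
  refine add_le_add (le_of_eq ?_) ?_
  · rw [Real.mul_rpow hc.le hn'.le, Real.rpow_sub_one hn'.ne']
    have h1 : (n : ℝ) ^ q ≠ 0 := (Real.rpow_pos_of_pos hn' q).ne'
    have h2 : c ^ q ≠ 0 := (Real.rpow_pos_of_pos hc q).ne'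
    field_simp
    rfl
  · have h1 : a * Real.log n / n * (c * n) = Real.log n * ((p - 1) / 2) := by
      rw [← hac]; field_simp
    have h2 : -(a * Real.log n / n) * (n * ε) = -(Real.log n * (q - 1)) := by
      rw [← haε]; field_simp
    rw [h1, h2, Real.exp_add, ← mul_assoc, Real.rpow_def_of_pos hn', ← Real.exp_add,
      add_neg_cancel, Real.exp_zero, one_mul, Real.exp_le_exp, ← Real.rpow_def_of_pos hn']
    refine le_trans (le_of_eq ?_) hn
    rw [Real.div_rpow (by positivity) hn'.le, Real.mul_rpow ha.le hlogn]
    have h3 : (n : ℝ) ^ p = n * ((n : ℝ) ^ ((p - 1) / 2) * (n : ℝ) ^ ((p - 1) / 2)) := by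
      rw [← Real.rpow_add hn', add_halves, Real.rpow_sub_one hn'.ne']
      field_simp
    have h4 : (n : ℝ) ^ ((p - 1) / 2) ≠ 0 := (Real.rpow_pos_of_pos hn' _).ne'
    rw [h3]
    field_simp
    rfl

/-- The probability that the empirical mean of `f ∈ L^q` deviates from its expectation
by at least `ε` is of order `n ^ (1 - q)`. -/
theorem rateBounded_le_abs_sum_sub {Ω : Type*} [MeasurableSpace Ω] {μ : Measure Ω}
    [IsProbabilityMeasure μ] {q ε : ℝ} (hq : 1 < q) (hε : 0 < ε) {f : Ω → ℝ} (hf : Measurable f)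
    (hfq : MemLp f (ENNReal.ofReal q) μ) :
    RateBounded μ q fun n => {w | ε ≤ |(n : ℝ)⁻¹ * ∑ i, f (w i) - ∫ ω, f ω ∂μ|} := by
  have hint : Integrable f μ := hfq.integrable (by simpa using hq.le)
  set m := ∫ ω, f ω ∂μ with hm
  have hup := rateBounded_le_sum (μ := μ) hq hε (hf.sub_const m)
    (by rw [integral_sub hint (integrable_const m)]; simp [hm]) (hfq.sub (memLp_const m))
  have hdown := rateBounded_le_sum (μ := μ) hq hε (hf.const_sub m)
    (by rw [integral_sub (integrable_const m) hint]; simp [hm]) ((memLp_const m).sub hfq)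
  refine (hup.union hdown).mono ?_
  filter_upwards [eventually_gt_atTop 0] with n hn w hw
  have hn' : (0 : ℝ) < n := Nat.cast_pos.2 hn
  have hmul : n * ((n : ℝ)⁻¹ * ∑ i, f (w i) - m) = ∑ i, f (w i) - n * m := by
    field_simp
  rcases le_abs.1 hw.out with h | h
  · left
    have := mul_le_mul_of_nonneg_left h hn'.le
    simp only [mem_ofPred_eq, Finset.sum_sub_distrib, Finset.sum_const, Finset.card_univ,
      Fintype.card_fin, nsmul_eq_mul]
    linarith
  · right
    have := mul_le_mul_of_nonneg_left h hn'.le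
    simp only [mem_ofPred_eq, Finset.sum_sub_distrib, Finset.sum_const, Finset.card_univ,
      Fintype.card_fin, nsmul_eq_mul]
    linarith

/-- Integration against the empirical measure is the sample mean. -/
theorem integral_empMeasure {E : Type*} [MeasurableSpace E] [MeasurableSingletonClass E] (n : ℕ)
    (w : Fin n → E) (f : E → ℝ) :
    ∫ z, f z ∂(empMeasure n w) = (n : ℝ)⁻¹ * ∑ i, f (w i) := by
  rw [empMeasure, integral_smul_measure,
    integral_finsetSum_measure fun i _ => integrable_dirac (by simp)]
  simp

/-- The oscillation of a dominated continuous family around a parameter is small in mean. -/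
theorem exists_nhds_oscillation_le {X E : Type*} [TopologicalSpace X]
    [TopologicalSpace.MetrizableSpace X] [CompactSpace X] [MeasurableSpace E] [TopologicalSpace E]
    [OpensMeasurableSpace E] {μ : Measure E} [IsFiniteMeasure μ] {r : ℝ≥0∞} (hr : 1 ≤ r)
    {h : X × E → ℝ} (hcont : Continuous h) {H : E → ℝ} (hH : MemLp H r μ)
    (hbound : ∀ x w, |h (x, w)| ≤ H w) {δ : ℝ} (hδ : 0 < δ) (x : X) :
    ∃ U ∈ 𝓝 x, ∃ g : E → ℝ, Measurable g ∧ MemLp g r μ ∧ ∫ w, g w ∂μ ≤ δ ∧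
      ∀ y ∈ U, ∀ w, |h (y, w) - h (x, w)| ≤ g w := by
  let _ := TopologicalSpace.metrizableSpaceMetric X
  let d : E → X → ℝ := fun w y => |h (y, w) - h (x, w)|
  have hd : Continuous ↿d := by
    change Continuous fun z : E × X => |h (z.2, z.1) - h (x, z.1)|
    fun_prop
  let K : ℕ → Set X := fun k => Metric.closedBall x (1 / ((k : ℝ) + 1))
  have hKx : ∀ k, x ∈ K k := fun k => Metric.mem_closedBall_self (by positivity)
  have hKc : ∀ k, IsCompact (K k) := fun k => Metric.isClosed_closedBall.isCompact
  let g : ℕ → E → ℝ := fun k w => sSup (d w '' K k)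
  have hgc : ∀ k, Measurable (g k) := fun k => ((hKc k).continuous_sSup hd).measurable
  have hdH : ∀ w y, d w y ≤ 2 * H w := fun w y =>
    (abs_sub _ _).trans (by linarith [hbound y w, hbound x w])
  have hle : ∀ k, ∀ y ∈ K k, ∀ w, d w y ≤ g k w := fun k y hy w =>
    le_csSup ⟨2 * H w, by rintro _ ⟨z, -, rfl⟩; exact hdH w z⟩ (mem_image_of_mem _ hy)
  have hg0 : ∀ k w, 0 ≤ g k w := fun k w => (abs_nonneg _).trans (hle k x (hKx k) w)
  have hgH : ∀ k w, ‖g k w‖ ≤ 2 * H w := fun k w => by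
    rw [Real.norm_eq_abs, abs_of_nonneg (hg0 k w)]
    exact csSup_le ⟨_, mem_image_of_mem _ (hKx k)⟩ (by rintro _ ⟨z, -, rfl⟩; exact hdH w z)
  have hlim : ∀ w, Tendsto (fun k => g k w) atTop (𝓝 0) := by
    intro w
    rw [Metric.tendsto_atTop]
    intro η hη
    have hdw : Continuous (d w) := hd.comp (by fun_prop : Continuous fun y : X => (w, y))
    have hev : ∀ᶠ y in 𝓝 x, d w y < η / 2 :=
      hdw.continuousAt.eventually_lt_const (by simpa [d] using half_pos hη)
    obtain ⟨ρ, hρ, hball⟩ := Metric.eventually_nhds_iff.1 hev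
    obtain ⟨N, hN⟩ := exists_nat_one_div_lt hρ
    refine ⟨N, fun k hk => ?_⟩
    have hkN : 1 / ((k : ℝ) + 1) ≤ 1 / ((N : ℝ) + 1) := Nat.one_div_le_one_div hk
    rw [Real.dist_0_eq_abs, abs_of_nonneg (hg0 k w)]
    refine lt_of_le_of_lt (csSup_le ⟨_, mem_image_of_mem _ (hKx k)⟩ ?_) (half_lt_self hη)
    rintro _ ⟨z, hz, rfl⟩
    exact (hball (lt_of_le_of_lt (Metric.mem_closedBall.1 hz) (hkN.trans_lt hN))).le
  have hint : Tendsto (fun k => ∫ w, g k w ∂μ) atTop (𝓝 (∫ _, (0 : ℝ) ∂μ)) :=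
    tendsto_integral_of_dominated_convergence (fun w => 2 * H w)
      (fun k => (hgc k).aestronglyMeasurable) ((hH.integrable hr).const_mul 2)
      (fun k => Eventually.of_forall (hgH k)) (Eventually.of_forall hlim)
  rw [integral_zero] at hint
  obtain ⟨k, hk⟩ := (hint.eventually_le_const hδ).exists
  exact ⟨K k, Metric.closedBall_mem_nhds x (by positivity), g k, hgc k,
    (hH.const_mul 2).mono' (hgc k).aestronglyMeasurable (Eventually.of_forall (hgH k)), hk, hle k⟩

/-- Infima of two uniformly close families are close. -/
theorem abs_ciInf_sub_ciInf_le {ι : Type*} [Nonempty ι] {a b : ι → ℝ} {δ : ℝ}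
    (ha : BddBelow (range a)) (hb : BddBelow (range b)) (hab : ∀ i, |a i - b i| ≤ δ) :
    |(⨅ i, a i) - ⨅ i, b i| ≤ δ := by
  have h1 : (⨅ i, a i) - δ ≤ ⨅ i, b i :=
    le_ciInf fun i => by linarith [ciInf_le ha i, (abs_le.1 (hab i)).2]
  have h2 : (⨅ i, b i) - δ ≤ ⨅ i, a i :=
    le_ciInf fun i => by linarith [ciInf_le hb i, (abs_le.1 (hab i)).1]
  exact abs_le.2 ⟨by linarith, by linarith⟩

/-- An empirical mean is close to the expectation if this holds for an approximating function and
for a bound on the approximation error. -/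
theorem abs_mean_sub_integral_le {E : Type*} [MeasurableSpace E] {μ : Measure E} {f f₀ g : E → ℝ}
    (hf : Integrable f μ) (hf₀ : Integrable f₀ μ) (hg : Integrable g μ)
    (hfg : ∀ z, |f z - f₀ z| ≤ g z) {δ : ℝ} (hgδ : ∫ z, g z ∂μ ≤ δ) {n : ℕ} {w : Fin n → E}
    (h₀ : |(n : ℝ)⁻¹ * ∑ i, f₀ (w i) - ∫ z, f₀ z ∂μ| ≤ δ)
    (h₁ : |(n : ℝ)⁻¹ * ∑ i, g (w i) - ∫ z, g z ∂μ| ≤ δ) :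
    |(n : ℝ)⁻¹ * ∑ i, f (w i) - ∫ z, f z ∂μ| ≤ 4 * δ := by
  have hsum : |(n : ℝ)⁻¹ * ∑ i, f (w i) - (n : ℝ)⁻¹ * ∑ i, f₀ (w i)| ≤
      (n : ℝ)⁻¹ * ∑ i, g (w i) := by
    rw [← mul_sub, abs_mul, abs_of_nonneg (by positivity : (0 : ℝ) ≤ (n : ℝ)⁻¹),
      ← Finset.sum_sub_distrib]
    gcongr
    exact (Finset.abs_sum_le_sum_abs _ _).trans (Finset.sum_le_sum fun i _ => hfg (w i))
  have hint : |∫ z, f z ∂μ - ∫ z, f₀ z ∂μ| ≤ ∫ z, g z ∂μ := by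
    rw [← integral_sub hf hf₀]
    exact (abs_integral_le_integral_abs).trans (integral_mono (hf.sub hf₀).abs hg hfg)
  rw [abs_le] at *
  constructor <;> linarith [hsum.1, hsum.2, hint.1, hint.2, h₀.1, h₀.2, h₁.1, h₁.2]

/-- A uniform law of large numbers with rate for a dominated continuous family indexed by a
compact space. -/
theorem rateBounded_compl_forall_abs_sub_le {X E : Type*} [TopologicalSpace X]
    [TopologicalSpace.MetrizableSpace X] [CompactSpace X] [MeasurableSpace E] [TopologicalSpace E]
    [OpensMeasurableSpace E] {μ : Measure E} [IsProbabilityMeasure μ] {q ε : ℝ} (hq : 1 < q)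
    (hε : 0 < ε) {h : X × E → ℝ} (hcont : Continuous h) {H : E → ℝ}
    (hH : MemLp H (ENNReal.ofReal q) μ) (hbound : ∀ x w, |h (x, w)| ≤ H w) :
    RateBounded μ q fun n =>
      {w | ∀ x, |(n : ℝ)⁻¹ * ∑ i, h (x, w i) - ∫ z, h (x, z) ∂μ| ≤ ε}ᶜ := by
  have hq1 : 1 ≤ ENNReal.ofReal q := by simpa using hq.le
  have hδ : 0 < ε / 4 := by positivity
  have hmeas : ∀ x, Measurable fun w => h (x, w) := fun x =>
    (hcont.comp (by fun_prop : Continuous fun w : E => (x, w))).measurable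
  have hLp : ∀ x, MemLp (fun w => h (x, w)) (ENNReal.ofReal q) μ := fun x =>
    hH.mono' (hmeas x).aestronglyMeasurable (Eventually.of_forall (hbound x))
  choose U hU g hgmeas hgLp hgint hUg using
    exists_nhds_oscillation_le hq1 hcont hH hbound hδ
  obtain ⟨s, hs⟩ := CompactSpace.elim_nhds_subcover U hU
  refine (RateBounded.biUnion s fun x _ =>
    (rateBounded_le_abs_sum_sub hq hδ (hmeas x) (hLp x)).union
      (rateBounded_le_abs_sum_sub hq hδ (hgmeas x) (hgLp x))).mono
    (Eventually.of_forall fun n w hw => ?_)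
  contrapose! hw
  simp only [mem_iUnion, mem_union, mem_ofPred_eq, not_exists, not_or, not_le] at hw
  rw [notMem_compl_iff]
  intro y
  obtain ⟨x, hx, hyx⟩ := mem_iUnion₂.1 (hs ▸ mem_univ y : y ∈ ⋃ x ∈ s, U x)
  have := abs_mean_sub_integral_le ((hLp y).integrable hq1) ((hLp x).integrable hq1)
    ((hgLp x).integrable hq1) (hUg x y hyx) (hgint x) (hw x hx).1.le (hw x hx).2.le
  linarith

/-- **Theorem 4.8** (Monte Carlo for stochastic optimization with heavy tails):
`μ^n(|V(L_n) − V(μ)| ≥ ε) = O(n^{1−q})`. -/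
theorem stochastic_optimization_rate
    {X : Type*} [TopologicalSpace X] [PolishSpace X] [CompactSpace X] [Nonempty X]
    {E : Type*} [MeasurableSpace E] [TopologicalSpace E] [PolishSpace E] [BorelSpace E]
    (q : ℝ) (hq1 : 1 < q)
    (h : X × E → ℝ) (hcont : Continuous h) (hbelow : ∃ C : ℝ, ∀ z, C ≤ h z)
    (hlevels : ∀ c : ℝ, IsCompact {z : X × E | h z ≤ c})
    (μ : Measure E) [IsProbabilityMeasure μ]
    (hmom : ∫⁻ w, ENNReal.ofReal (max (⨆ x : X, h (x, w)) 0 ^ q) ∂μ ≠ ⊤)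
    (ε : ℝ) (hε : 0 < ε) :
    Filter.limsup (fun n : ℕ =>
        (n : ℝ≥0∞) ^ (q - 1) *
          Measure.pi (fun _ : Fin n => μ)
            {w : Fin n → E | ε ≤
              |(⨅ x : X, ∫ z, h (x, z) ∂(empMeasure n w)) - ⨅ x : X, ∫ z, h (x, z) ∂μ|})
      Filter.atTop < ⊤ := by
  obtain ⟨C, hC⟩ := hbelow
  have hq0 : 0 < q := zero_lt_one.trans hq1
  have hψ : Continuous fun w => ⨆ x : X, h (x, w) := by
    have := isCompact_univ.continuous_sSup
      (f := fun (w : E) (x : X) => h (x, w)) (hcont.comp continuous_swap)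
    simpa only [image_univ, sSup_range] using this
  set H : E → ℝ := fun w => |C| + max (⨆ x : X, h (x, w)) 0
  have hbound : ∀ x w, |h (x, w)| ≤ H w := by
    intro x w
    have hbdd : BddAbove (range fun x : X => h (x, w)) :=
      (isCompact_range (hcont.comp (by fun_prop : Continuous fun x : X => (x, w)))).bddAbove
    have h1 := (le_ciSup hbdd x).trans (le_max_left _ 0)
    have h2 := le_max_right (⨆ x : X, h (x, w)) 0
    exact abs_le.2 ⟨by linarith [hC (x, w), neg_abs_le C], by linarith [abs_nonneg C]⟩
  have hψLp : MemLp (fun w => max (⨆ x : X, h (x, w)) 0) (ENNReal.ofReal q) μ := by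
    refine ⟨(hψ.max continuous_const).measurable.aestronglyMeasurable, ?_⟩
    rw [eLpNorm_lt_top_iff_lintegral_rpow_enorm_lt_top (by simpa using hq0) ENNReal.ofReal_ne_top,
      ENNReal.toReal_ofReal hq0.le]
    refine lt_of_le_of_lt (le_of_eq (lintegral_congr fun w => ?_)) hmom.lt_top
    rw [Real.enorm_of_nonneg (le_max_right _ _),
      ENNReal.ofReal_rpow_of_nonneg (le_max_right _ _) hq0.le]
  have hH : MemLp H (ENNReal.ofReal q) μ := (memLp_const |C|).add hψLp
  have hint : ∀ x, Integrable (fun w => h (x, w)) μ := fun x =>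
    (hH.integrable (by simpa using hq1.le)).mono'
      (hcont.comp (by fun_prop : Continuous fun w : E => (x, w))).measurable.aestronglyMeasurable
      (Eventually.of_forall (hbound x))
  refine RateBounded.limsup_lt_top hq1.le
    ((rateBounded_compl_forall_abs_sub_le hq1 (half_pos hε) hcont hH hbound).mono ?_)
  filter_upwards [eventually_gt_atTop 0] with n hn w hw hclose
  have hn' : (0 : ℝ) < n := Nat.cast_pos.2 hn
  have hle : |(⨅ x : X, ∫ z, h (x, z) ∂(empMeasure n w)) - ⨅ x : X, ∫ z, h (x, z) ∂μ| ≤ ε / 2 := by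
    simp_rw [integral_empMeasure]
    refine abs_ciInf_sub_ciInf_le ⟨C, ?_⟩ ⟨C, ?_⟩ hclose
    · rintro _ ⟨x, rfl⟩
      change C ≤ (n : ℝ)⁻¹ * ∑ i, h (x, w i)
      rw [← div_eq_inv_mul, le_div_iff₀ hn', mul_comm]
      simpa using Finset.card_nsmul_le_sum Finset.univ _ C fun i _ => hC (x, w i)
    · rintro _ ⟨x, rfl⟩
      simpa using integral_mono (integrable_const C) (hint x) fun z => hC (x, z)
  linarith [hw.out]

end SanovDual
end
end
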